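/- arXiv:2405.06339 — 2 statements merged into one kernel-verified Lean document; each statement's English description precedes it below -/
import Mathlib

section
/- Let X_S and X_M be independent random variables with CDFs F_S(x) = 1 - exp(-2λ_S x) and F_M(x) = 1 - exp(-λ_M π x²) for x ≥ 0, where λ_S, λ_M > 0, let α_S, α_M > 0, and let A > 0. Then the probability of Case 4, ℙ(A·X_M^{-α_M} < X_S^{-α_S}) = ℙ(X_S < A^{-1/α_S} X_M^{α_M/α_S}), equals ∫_0^∞ 2λ_S exp(-λ_M π A^{2/α_M} x^{2α_S/α_M} - 2λ_S x) dx. -/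
open MeasureTheory ProbabilityTheory Real Set

/-- A random variable whose CDF vanishes at `0` is almost surely positive. -/
lemma ae_pos_of_measure_le_zero {Ω : Type*} [MeasurableSpace Ω] {μ : Measure Ω} {X : Ω → ℝ}
    (h : μ {ω | X ω ≤ 0} = 0) : ∀ᵐ ω ∂μ, 0 < X ω := by
  rw [ae_iff]
  simpa only [not_lt] using h

/-- A random variable with the CDF of an exponential distribution has the exponential law. -/
lemma map_eq_expMeasure_of_cdf {Ω : Type*} [MeasurableSpace Ω] {μ : Measure Ω}
    [IsProbabilityMeasure μ] {X : Ω → ℝ} (hX : Measurable X) {r : ℝ} (hr : 0 < r)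
    (hF : ∀ x : ℝ, 0 ≤ x → μ {ω | X ω ≤ x} = ENNReal.ofReal (1 - Real.exp (-(r * x))))
    (hFneg : ∀ x : ℝ, x < 0 → μ {ω | X ω ≤ x} = 0) :
    μ.map X = expMeasure r := by
  have := isProbabilityMeasure_expMeasure hr
  have := Measure.isProbabilityMeasure_map (μ := μ) hX.aemeasurable
  refine Measure.ext_of_Iic _ _ fun x => ?_
  rw [← ofReal_cdf (expMeasure r), cdf_expMeasure_eq hr, Measure.map_apply hX measurableSet_Iic]
  split_ifs with hx
  · exact hF x hx
  · rw [ENNReal.ofReal_zero]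
    exact hFneg x (not_le.mp hx)

/-- Integration against the exponential law, as an integral over the positive half-line. -/
lemma lintegral_expMeasure (r : ℝ) {g : ℝ → ENNReal} (hg : Measurable g) :
    ∫⁻ x, g x ∂expMeasure r
      = ∫⁻ x in Ioi (0 : ℝ), ENNReal.ofReal (r * Real.exp (-(r * x))) * g x := by
  have hm : Measurable (exponentialPDF r) := (measurable_exponentialPDFReal r).ennreal_ofReal
  change ∫⁻ x, g x ∂(volume.withDensity (exponentialPDF r)) = _
  rw [lintegral_withDensity_eq_lintegral_mul _ hm hg, setLIntegral_congr Ioi_ae_eq_Ici,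
    ← lintegral_indicator measurableSet_Ici]
  refine lintegral_congr fun x => ?_
  by_cases hx : 0 ≤ x
  · simp [hx, exponentialPDF_of_nonneg]
  · simp [hx, exponentialPDF_of_neg (not_le.mp hx)]

/-- Solving the biased power-law comparison for the first distance. -/
lemma mul_rpow_neg_lt_rpow_neg_iff_left {a b A x y : ℝ} (ha : 0 < a) (hA : 0 < A)
    (hx : 0 < x) (hy : 0 < y) :
    A * y ^ (-b) < x ^ (-a) ↔ x < A ^ (-(1 / a)) * y ^ (b / a) := by
  rw [← Real.log_lt_log_iff (by positivity) (by positivity),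
    ← Real.log_lt_log_iff hx (by positivity), Real.log_mul (by positivity) (by positivity),
    Real.log_mul (by positivity) (by positivity), Real.log_rpow hy, Real.log_rpow hx,
    Real.log_rpow hA, Real.log_rpow hy,
    ← mul_lt_mul_iff_right₀ (b := Real.log x) ha]
  have h : a * (-(1 / a) * Real.log A + b / a * Real.log y) = -Real.log A + b * Real.log y := by
    field_simp
  rw [h]
  constructor <;> intro <;> linarith

/-- Solving the biased power-law comparison for the second distance. -/
lemma mul_rpow_neg_lt_rpow_neg_iff_right {a b A x y : ℝ} (hb : 0 < b) (hA : 0 < A)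
    (hx : 0 < x) (hy : 0 < y) :
    A * y ^ (-b) < x ^ (-a) ↔ A ^ (1 / b) * x ^ (a / b) < y := by
  rw [← Real.log_lt_log_iff (by positivity) (by positivity),
    ← Real.log_lt_log_iff (by positivity) hy, Real.log_mul (by positivity) (by positivity),
    Real.log_mul (by positivity) (by positivity), Real.log_rpow hy, Real.log_rpow hx,
    Real.log_rpow hA, Real.log_rpow hx,
    ← mul_lt_mul_iff_right₀ (c := Real.log y) hb]
  have h : b * (1 / b * Real.log A + a / b * Real.log x) = Real.log A + a * Real.log x := by
    field_simp
  rw [h]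
  constructor <;> intro <;> linarith

/-- The probability that one independent variable exceeds a function of another. -/
lemma measure_comp_lt_of_indepFun {Ω : Type*} [MeasurableSpace Ω] {μ : Measure Ω}
    [IsFiniteMeasure μ] {X Y : Ω → ℝ} (hX : Measurable X) (hY : Measurable Y)
    (h : IndepFun X Y μ) {f : ℝ → ℝ} (hf : Measurable f) :
    μ {ω | f (X ω) < Y ω} = ∫⁻ x, μ {ω | f x < Y ω} ∂(μ.map X) := by
  have hs : MeasurableSet {p : ℝ × ℝ | f p.1 < p.2} :=
    measurableSet_lt (hf.comp measurable_fst) measurable_snd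
  change μ ((fun ω => (X ω, Y ω)) ⁻¹' {p : ℝ × ℝ | f p.1 < p.2}) = _
  rw [← Measure.map_apply (hX.prodMk hY) hs,
    (indepFun_iff_map_prod_eq_prod_map_map hX.aemeasurable hY.aemeasurable).mp h,
    Measure.prod_apply hs]
  refine lintegral_congr fun x => ?_
  exact Measure.map_apply hY (s := Ioi (f x)) measurableSet_Ioi

theorem case4_association_probability
    {Ω : Type*} [MeasurableSpace Ω] (μ : Measure Ω) [IsProbabilityMeasure μ]
    (XS XM : Ω → ℝ) (hXSm : Measurable XS) (hXMm : Measurable XM)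
    (hindep : IndepFun XS XM μ)
    (lamS lamM αS αM A : ℝ)
    (hlamS : 0 < lamS) (hlamM : 0 < lamM)
    (hαS : 0 < αS) (hαM : 0 < αM) (hA : 0 < A)
    (hFS : ∀ x : ℝ, 0 ≤ x →
      μ {ω | XS ω ≤ x} = ENNReal.ofReal (1 - Real.exp (-(2 * lamS * x))))
    (hFSneg : ∀ x : ℝ, x < 0 → μ {ω | XS ω ≤ x} = 0)
    (hFM : ∀ x : ℝ, 0 ≤ x →
      μ {ω | XM ω ≤ x} = ENNReal.ofReal (1 - Real.exp (-(lamM * π * x ^ 2))))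
    (hFMneg : ∀ x : ℝ, x < 0 → μ {ω | XM ω ≤ x} = 0) :
    μ {ω | A * XM ω ^ (-αM) < XS ω ^ (-αS)}
      = μ {ω | XS ω < A ^ (-(1 / αS)) * XM ω ^ (αM / αS)} ∧
    μ {ω | A * XM ω ^ (-αM) < XS ω ^ (-αS)}
      = ENNReal.ofReal (∫ x in Set.Ioi (0 : ℝ),
          2 * lamS * Real.exp (-(lamM * π * A ^ (2 / αM) * x ^ (2 * αS / αM)) - 2 * lamS * x)) := by
  have hSpos : ∀ᵐ ω ∂μ, 0 < XS ω := ae_pos_of_measure_le_zero (by simp [hFS 0 le_rfl])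
  have hMpos : ∀ᵐ ω ∂μ, 0 < XM ω := ae_pos_of_measure_le_zero (by simp [hFM 0 le_rfl])
  refine ⟨?_, ?_⟩
  · apply measure_congr
    filter_upwards [hSpos, hMpos] with ω hS hM
    exact propext (mul_rpow_neg_lt_rpow_neg_iff_left hαS hA hS hM)
  have hr : 0 < 2 * lamS := by positivity
  set f : ℝ → ℝ := fun x => A ^ (1 / αM) * x ^ (αS / αM) with hf
  have hfm : Measurable f := by fun_prop
  have hset : μ {ω | A * XM ω ^ (-αM) < XS ω ^ (-αS)} = μ {ω | f (XS ω) < XM ω} := by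
    apply measure_congr
    filter_upwards [hSpos, hMpos] with ω hS hM
    exact propext (mul_rpow_neg_lt_rpow_neg_iff_right hαM hA hS hM)
  have htail : ∀ y : ℝ, 0 ≤ y →
      μ {ω | y < XM ω} = ENNReal.ofReal (Real.exp (-(lamM * π * y ^ 2))) := by
    intro y hy
    have hc : {ω | y < XM ω} = {ω | XM ω ≤ y}ᶜ := by ext; simp
    have hle : Real.exp (-(lamM * π * y ^ 2)) ≤ 1 := by
      rw [Real.exp_le_one_iff, neg_nonpos]; positivity
    rw [hc, prob_compl_eq_one_sub (measurableSet_le hXMm measurable_const), hFM y hy,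
      ← ENNReal.ofReal_one, ← ENNReal.ofReal_sub _ (by linarith), sub_sub_cancel]
  have hsq : ∀ x : ℝ, 0 < x → f x ^ 2 = A ^ (2 / αM) * x ^ (2 * αS / αM) := by
    intro x hx
    rw [hf, mul_pow, ← Real.rpow_mul_natCast hA.le, ← Real.rpow_mul_natCast hx.le]
    push_cast
    congr 2 <;> ring
  have hanti : Antitone fun y : ℝ => μ {ω | y < XM ω} :=
    fun a b hab => measure_mono fun ω (hω : b < XM ω) => lt_of_le_of_lt hab hω
  rw [hset, measure_comp_lt_of_indepFun hXSm hXMm hindep hfm,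
    map_eq_expMeasure_of_cdf hXSm hr hFS hFSneg,
    lintegral_expMeasure _ (g := fun x => μ {ω | f x < XM ω}) (hanti.measurable.comp hfm),
    ofReal_integral_eq_lintegral_ofReal]
  · refine setLIntegral_congr_fun measurableSet_Ioi fun x (hx : 0 < x) => ?_
    have hfx : 0 ≤ f x := by simp only [hf]; positivity
    rw [htail _ hfx, ← ENNReal.ofReal_mul (by positivity), hsq x hx, mul_assoc, ← Real.exp_add]
    congr 3
    ring
  · refine ((exp_neg_integrableOn_Ioi 0 hr).const_mul (2 * lamS)).mono'
      (by fun_prop) ?_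
    filter_upwards [ae_restrict_mem measurableSet_Ioi] with x (hx : 0 < x)
    rw [Real.norm_of_nonneg (by positivity)]
    gcongr
    have : 0 ≤ lamM * π * A ^ (2 / αM) * x ^ (2 * αS / αM) := by positivity
    linarith
  · filter_upwards with x
    simp only [Pi.zero_apply]
    positivity
end

section
/- Let X_S and X_M be independent random variables with CDFs F_S(x) = 1 - exp(-2λ_S x) and F_M(x) = 1 - exp(-λ_M π x²) for x ≥ 0, where λ_S, λ_M > 0, let α_S, α_M > 0 and 0 < B < A, and suppose ℙ(Case 2) > 0 where Case 2 = {B·X_M^{-α_M} < X_S^{-α_S} < A·X_M^{-α_M}}. Then for every x ≥ 0 the conditional distribution of the serving-MBS (downlink) distance satisfies ℙ(X_M > x | Case 2) = (1/ℙ(Case 2)) · ∫_x^∞ [exp(-2λ_S A^{-1/α_S} u^{α_M/α_S}) - exp(-2λ_S B^{-1/α_S} u^{α_M/α_S})] · 2π λ_M u · exp(-λ_M π u²) du. -/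
open MeasureTheory ProbabilityTheory Real Set

/-- A finite measure whose distribution function is exponential is `expMeasure`. -/
lemma eq_expMeasure_of_measure_Iic {ν : Measure ℝ} [IsFiniteMeasure ν] {r : ℝ} (hr : 0 < r)
    (hpos : ∀ x : ℝ, 0 ≤ x → ν (Iic x) = ENNReal.ofReal (1 - exp (-(r * x))))
    (hneg : ∀ x : ℝ, x < 0 → ν (Iic x) = 0) : ν = expMeasure r := by
  have := isProbabilityMeasure_expMeasure hr
  refine Measure.ext_of_Iic _ _ fun a => ?_
  rw [← ofReal_cdf (expMeasure r), cdf_expMeasure_eq hr]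
  split_ifs with h
  · exact hpos a h
  · simpa using hneg a (not_le.mp h)

lemma expMeasure_Ioo {r a b : ℝ} (hr : 0 < r) (ha : 0 ≤ a) (hab : a ≤ b) :
    expMeasure r (Ioo a b) = ENNReal.ofReal (exp (-(r * a)) - exp (-(r * b))) := by
  have := isProbabilityMeasure_expMeasure hr
  have : NullSingletonClass (expMeasure r) :=
    ⟨fun x => withDensity_absolutelyContinuous _ _ (measure_singleton x)⟩
  have hb : 0 ≤ b := ha.trans hab
  have ha' : exp (-(r * a)) ≤ 1 := exp_le_one_iff.2 (neg_nonpos.2 (by positivity))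
  rw [measure_congr Ioo_ae_eq_Ioc, ← Iic_sdiff_Iic,
    measure_sdiff (Iic_subset_Iic.2 hab) measurableSet_Iic.nullMeasurableSet (measure_ne_top _ _),
    ← ofReal_cdf, ← ofReal_cdf, cdf_expMeasure_eq hr, cdf_expMeasure_eq hr, if_pos ha, if_pos hb,
    ← ENNReal.ofReal_sub _ (by linarith)]
  congr 1
  ring

lemma expMeasure_Iic_zero {r : ℝ} (hr : 0 < r) : expMeasure r (Iic 0) = 0 := by
  have := isProbabilityMeasure_expMeasure hr
  rw [← ofReal_cdf, cdf_expMeasure_eq hr]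
  simp

lemma integrable_rayleigh_density {c : ℝ} (hc : 0 < c) :
    Integrable fun u : ℝ => 2 * π * c * u * exp (-(c * π * u ^ 2)) := by
  refine ((integrable_mul_exp_neg_mul_sq (b := c * π) (by positivity)).const_mul
    (2 * π * c)).congr (.of_forall fun u => ?_)
  simp only [neg_mul, mul_assoc]

/-- A finite measure with a Rayleigh distribution function has the Rayleigh density. -/
lemma eq_withDensity_rayleigh_of_measure_Iic {ν : Measure ℝ} [IsFiniteMeasure ν] {c : ℝ}
    (hc : 0 < c)
    (hpos : ∀ x : ℝ, 0 ≤ x → ν (Iic x) = ENNReal.ofReal (1 - exp (-(c * π * x ^ 2))))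
    (hneg : ∀ x : ℝ, x < 0 → ν (Iic x) = 0) :
    ν = (volume.restrict (Ioi 0)).withDensity
      fun u : ℝ => ENNReal.ofReal (2 * π * c * u * exp (-(c * π * u ^ 2))) := by
  refine Measure.ext_of_Iic _ _ fun a => ?_
  rw [withDensity_apply _ measurableSet_Iic, Measure.restrict_restrict measurableSet_Iic,
    Iic_inter_Ioi]
  rcases lt_or_ge a 0 with h | h
  · rw [hneg a h, Ioc_eq_empty (not_lt.2 h.le)]
    simp
  rw [hpos a h, ← ofReal_integral_eq_lintegral_ofReal (integrable_rayleigh_density hc).integrableOn,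
    ← intervalIntegral.integral_of_le h]
  · congr 1
    rw [intervalIntegral.integral_eq_sub_of_hasDerivAt (f := fun u => -exp (-(c * π * u ^ 2)))
      _ (integrable_rayleigh_density hc).intervalIntegrable]
    · simp
      ring
    · intro u _
      convert! (((hasDerivAt_pow 2 u).const_mul (c * π)).neg.exp).neg using 1
      simp
      ring
  · filter_upwards [ae_restrict_mem measurableSet_Ioc] with u hu
    have := hu.1
    simp only [Pi.zero_apply]
    positivity

lemma rpow_threshold_rpow {c u α β : ℝ} (hc : 0 < c) (hu : 0 < u) (hα : 0 < α) :
    (c ^ (-(1 / α)) * u ^ (β / α)) ^ (-α) = c * u ^ (-β) := by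
  rw [mul_rpow (by positivity) (by positivity), ← rpow_mul hc.le, ← rpow_mul hu.le]
  have h₁ : -(1 / α) * -α = 1 := by field_simp
  have h₂ : β / α * -α = -β := by field_simp
  rw [h₁, h₂, rpow_one]

lemma mul_rpow_lt_rpow_iff {c u s α β : ℝ} (hc : 0 < c) (hu : 0 < u) (hs : 0 < s) (hα : 0 < α) :
    c * u ^ (-β) < s ^ (-α) ↔ s < c ^ (-(1 / α)) * u ^ (β / α) := by
  rw [← rpow_threshold_rpow hc hu hα]
  exact rpow_lt_rpow_iff_of_neg (by positivity) hs (neg_lt_zero.2 hα)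

lemma rpow_lt_mul_rpow_iff {c u s α β : ℝ} (hc : 0 < c) (hu : 0 < u) (hs : 0 < s) (hα : 0 < α) :
    s ^ (-α) < c * u ^ (-β) ↔ c ^ (-(1 / α)) * u ^ (β / α) < s := by
  rw [← rpow_threshold_rpow hc hu hα]
  exact rpow_lt_rpow_iff_of_neg hs (by positivity) (neg_lt_zero.2 hα)

lemma threshold_le_threshold {A B u α β : ℝ} (hB : 0 < B) (hBA : B < A) (hu : 0 < u)
    (hα : 0 < α) :
    A ^ (-(1 / α)) * u ^ (β / α) ≤ B ^ (-(1 / α)) * u ^ (β / α) := by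
  have : A ^ (-(1 / α)) ≤ B ^ (-(1 / α)) :=
    rpow_le_rpow_of_nonpos hB hBA.le (neg_nonpos.2 (by positivity))
  gcongr

/-- The probability that an exponential variable satisfies the decoupling condition. -/
lemma expMeasure_decoupled {r A B u α β : ℝ} (hr : 0 < r) (hB : 0 < B) (hBA : B < A) (hu : 0 < u)
    (hα : 0 < α) :
    expMeasure r {s | B * u ^ (-β) < s ^ (-α) ∧ s ^ (-α) < A * u ^ (-β)} =
      ENNReal.ofReal (exp (-(r * A ^ (-(1 / α)) * u ^ (β / α))) -
        exp (-(r * B ^ (-(1 / α)) * u ^ (β / α)))) := by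
  have hA : 0 < A := hB.trans hBA
  rw [mul_assoc, mul_assoc, ← expMeasure_Ioo hr (by positivity)
    (threshold_le_threshold hB hBA hu hα)]
  refine measure_congr ?_
  filter_upwards [measure_eq_zero_iff_ae_notMem.1 (expMeasure_Iic_zero hr)] with s hs
  have hs : 0 < s := by simpa using hs
  exact propext (by
    change (_ ∧ _) ↔ (_ ∧ _)
    rw [mul_rpow_lt_rpow_iff hB hu hs hα, rpow_lt_mul_rpow_iff hA hu hs hα, and_comm])

lemma integrableOn_decoupled_density {r A B c x α β : ℝ} (hr : 0 < r) (hA : 0 < A) (hB : 0 < B)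
    (hc : 0 < c) (hx : 0 ≤ x) :
    IntegrableOn (fun u : ℝ => (exp (-(r * A ^ (-(1 / α)) * u ^ (β / α))) -
        exp (-(r * B ^ (-(1 / α)) * u ^ (β / α)))) *
          (2 * π * c * u * exp (-(c * π * u ^ 2)))) (Ioi x) := by
  refine (integrable_rayleigh_density hc).integrableOn.bdd_mul (c := 1)
    (by fun_prop) ?_
  filter_upwards [ae_restrict_mem measurableSet_Ioi] with u hu
  have hu : 0 < u := lt_of_le_of_lt hx hu
  have h₁ : exp (-(r * A ^ (-(1 / α)) * u ^ (β / α))) ≤ 1 :=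
    exp_le_one_iff.2 (neg_nonpos.2 (by positivity))
  have h₂ : exp (-(r * B ^ (-(1 / α)) * u ^ (β / α))) ≤ 1 :=
    exp_le_one_iff.2 (neg_nonpos.2 (by positivity))
  rw [norm_eq_abs, abs_le]
  constructor <;> linarith [exp_pos (-(r * A ^ (-(1 / α)) * u ^ (β / α))),
    exp_pos (-(r * B ^ (-(1 / α)) * u ^ (β / α)))]

theorem case2_serving_MBS_distance_distribution
    {Ω : Type*} [MeasurableSpace Ω] (μ : Measure Ω) [IsProbabilityMeasure μ]
    (XS XM : Ω → ℝ) (hXSm : Measurable XS) (hXMm : Measurable XM)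
    (hindep : IndepFun XS XM μ)
    (lamS lamM αS αM A B : ℝ)
    (hlamS : 0 < lamS) (hlamM : 0 < lamM)
    (hαS : 0 < αS) (hαM : 0 < αM) (hB : 0 < B) (hBA : B < A)
    (hFS : ∀ x : ℝ, 0 ≤ x →
      μ {ω | XS ω ≤ x} = ENNReal.ofReal (1 - Real.exp (-(2 * lamS * x))))
    (hFSneg : ∀ x : ℝ, x < 0 → μ {ω | XS ω ≤ x} = 0)
    (hFM : ∀ x : ℝ, 0 ≤ x →
      μ {ω | XM ω ≤ x} = ENNReal.ofReal (1 - Real.exp (-(lamM * π * x ^ 2))))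
    (hFMneg : ∀ x : ℝ, x < 0 → μ {ω | XM ω ≤ x} = 0)
    (hpos : 0 < μ {ω | B * XM ω ^ (-αM) < XS ω ^ (-αS) ∧ XS ω ^ (-αS) < A * XM ω ^ (-αM)}) :
    ∀ x : ℝ, 0 ≤ x →
      μ[|{ω | B * XM ω ^ (-αM) < XS ω ^ (-αS) ∧ XS ω ^ (-αS) < A * XM ω ^ (-αM)}] {ω | x < XM ω}
        = ENNReal.ofReal
            ((μ {ω | B * XM ω ^ (-αM) < XS ω ^ (-αS) ∧ XS ω ^ (-αS) < A * XM ω ^ (-αM)}).toReal⁻¹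
              * ∫ u in Set.Ioi x,
                  (Real.exp (-(2 * lamS * A ^ (-(1 / αS)) * u ^ (αM / αS)))
                    - Real.exp (-(2 * lamS * B ^ (-(1 / αS)) * u ^ (αM / αS))))
                    * (2 * π * lamM * u * Real.exp (-(lamM * π * u ^ 2)))) := by
  intro x hx
  have hA : 0 < A := hB.trans hBA
  have hr : 0 < 2 * lamS := by positivity
  have := isProbabilityMeasure_expMeasure hr
  have := Measure.isProbabilityMeasure_map (μ := μ) hXMm.aemeasurable
  have := Measure.isProbabilityMeasure_map (μ := μ) hXSm.aemeasurable
  have hS : μ.map XS = expMeasure (2 * lamS) := by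
    refine eq_expMeasure_of_measure_Iic hr (fun y hy => ?_) fun y hy => ?_ <;>
      rw [Measure.map_apply hXSm measurableSet_Iic]
    exacts [hFS y hy, hFSneg y hy]
  have hM := eq_withDensity_rayleigh_of_measure_Iic (ν := μ.map XM) hlamM
    (fun y hy => by rw [Measure.map_apply hXMm measurableSet_Iic]; exact hFM y hy)
    (fun y hy => by rw [Measure.map_apply hXMm measurableSet_Iic]; exact hFMneg y hy)
  have hmeas : MeasurableSet
      {ω | B * XM ω ^ (-αM) < XS ω ^ (-αS) ∧ XS ω ^ (-αS) < A * XM ω ^ (-αM)} := by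
    measurability
  let E : Set (ℝ × ℝ) :=
    {p | (B * p.1 ^ (-αM) < p.2 ^ (-αS) ∧ p.2 ^ (-αS) < A * p.1 ^ (-αM)) ∧ x < p.1}
  have hE : MeasurableSet E := by
    measurability
  have hprod := (indepFun_iff_map_prod_eq_prod_map_map hXMm.aemeasurable hXSm.aemeasurable).1
    hindep.symm
  have hsection : ∀ u ∈ Ioi (0 : ℝ),
      ENNReal.ofReal (2 * π * lamM * u * exp (-(lamM * π * u ^ 2))) *
        expMeasure (2 * lamS) (Prod.mk u ⁻¹' E) =
      (Ioi x).indicator (fun u => ENNReal.ofReal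
        ((exp (-(2 * lamS * A ^ (-(1 / αS)) * u ^ (αM / αS)))
          - exp (-(2 * lamS * B ^ (-(1 / αS)) * u ^ (αM / αS))))
          * (2 * π * lamM * u * exp (-(lamM * π * u ^ 2))))) u := by
    intro u (hu : 0 < u)
    by_cases hxu : x < u
    · have h : Prod.mk u ⁻¹' E =
          {s | B * u ^ (-αM) < s ^ (-αS) ∧ s ^ (-αS) < A * u ^ (-αM)} := by
        ext s
        simp [E, hxu]
      rw [h, expMeasure_decoupled hr hB hBA hu hαS, indicator_of_mem (mem_Ioi.2 hxu),
        mul_comm, ← ENNReal.ofReal_mul' (by positivity)]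
    · have h : Prod.mk u ⁻¹' E = ∅ := by
        ext s
        simp [E, hxu]
      rw [h, indicator_of_notMem (by simpa using hxu)]
      simp
  have hjoint : μ ({ω | B * XM ω ^ (-αM) < XS ω ^ (-αS) ∧ XS ω ^ (-αS) < A * XM ω ^ (-αM)} ∩
      {ω | x < XM ω}) = ENNReal.ofReal (∫ u in Ioi x,
        (exp (-(2 * lamS * A ^ (-(1 / αS)) * u ^ (αM / αS)))
          - exp (-(2 * lamS * B ^ (-(1 / αS)) * u ^ (αM / αS))))
          * (2 * π * lamM * u * exp (-(lamM * π * u ^ 2)))) := by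
    calc _ = μ.map (fun ω => (XM ω, XS ω)) E := by
          rw [Measure.map_apply (hXMm.prodMk hXSm) hE]
          rfl
      _ = ∫⁻ u, expMeasure (2 * lamS) (Prod.mk u ⁻¹' E) ∂(μ.map XM) := by
          rw [hprod, hS, Measure.prod_apply hE]
      _ = ∫⁻ u in Ioi x, ENNReal.ofReal
            ((exp (-(2 * lamS * A ^ (-(1 / αS)) * u ^ (αM / αS)))
              - exp (-(2 * lamS * B ^ (-(1 / αS)) * u ^ (αM / αS))))
              * (2 * π * lamM * u * exp (-(lamM * π * u ^ 2)))) := by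
          rw [hM, lintegral_withDensity_eq_lintegral_mul _ (by fun_prop)
            (measurable_measure_prodMk_left hE)]
          simp only [Pi.mul_apply]
          rw [setLIntegral_congr_fun measurableSet_Ioi hsection,
            lintegral_indicator measurableSet_Ioi, Measure.restrict_restrict measurableSet_Ioi,
            inter_eq_left.2 (Ioi_subset_Ioi hx)]
      _ = _ := by
          refine (ofReal_integral_eq_lintegral_ofReal
            (integrableOn_decoupled_density hr hA hB hlamM hx) ?_).symm
          filter_upwards [ae_restrict_mem measurableSet_Ioi] with u hu
          have hu : 0 < u := lt_of_le_of_lt hx hu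
          have h := threshold_le_threshold (β := αM) hB hBA hu hαS
          refine mul_nonneg (sub_nonneg.2 (exp_le_exp.2 (neg_le_neg ?_))) (by positivity)
          simpa only [mul_assoc] using mul_le_mul_of_nonneg_left h hr.le
  rw [cond_apply hmeas, hjoint, ENNReal.ofReal_mul (by positivity),
    ENNReal.ofReal_inv_of_pos (ENNReal.toReal_pos hpos.ne' (measure_ne_top _ _)),
    ENNReal.ofReal_toReal (measure_ne_top _ _)]
end
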